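/- arXiv:2512.11804 — 8 statements merged into one kernel-verified Lean document; each statement's English description precedes it below -/
import Mathlib

section
/- For every r > R, the improper integral v_R(r) := ∫_r^∞ F(ρ) dρ is finite and strictly positive; v_R is differentiable on (R,∞) with v_R'(r) = −F(r) = −r^{1−N}/√(R^{2−2N} − r^{2−2N}); and v_R satisfies the radial minimal surface equation r^{N−1} v_R'(r)/√(1 + v_R'(r)²) = −R^{N−1} for every r > R. -/
open MeasureTheory Filter Set

theorem hasDerivAt_integral_Ioi {f : ℝ → ℝ} {a r : ℝ} (har : a < r)
    (hf : IntegrableOn f (Ioi a)) (hc : ContinuousAt f r) :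
    HasDerivAt (fun s => ∫ x in Ioi s, f x) (-(f r)) r := by
  have hint : IntervalIntegrable f volume a r :=
    (intervalIntegrable_iff_integrableOn_Ioc_of_le har.le).2 (hf.mono_set Ioc_subset_Ioi_self)
  have hmeas : StronglyMeasurableAtFilter f (nhds r) volume :=
    ⟨Ioi a, Ioi_mem_nhds har, hf.aestronglyMeasurable⟩
  have hderiv := (intervalIntegral.integral_hasDerivAt_right hint hmeas hc).const_sub
    (∫ x in Ioi a, f x)
  refine hderiv.congr_of_eventuallyEq ?_
  filter_upwards [Ioi_mem_nhds har] with s hs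
  have hs : a < s := hs
  have := intervalIntegral.integral_interval_add_Ioi
    hf (hf.mono_set (Ioi_subset_Ioi hs.le))
  linarith

theorem rpow_two_sub_two_mul_eq_sq {x : ℝ} (hx : 0 < x) (N : ℝ) :
    x ^ (2 - 2 * N) = (x ^ (1 - N)) ^ 2 := by
  rw [← Real.rpow_mul_natCast hx.le]
  congr 1
  push_cast
  ring

theorem div_sqrt_one_add_div_sqrt_sq {A a : ℝ} (ha : 0 < a) (haA : a < A) :
    a / √(A ^ 2 - a ^ 2) / √(1 + (a / √(A ^ 2 - a ^ 2)) ^ 2) = a / A := by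
  have hA : 0 < A := ha.trans haA
  have hD : 0 < A ^ 2 - a ^ 2 := by nlinarith
  have h : 1 + (a / √(A ^ 2 - a ^ 2)) ^ 2 = (A / √(A ^ 2 - a ^ 2)) ^ 2 := by
    rw [div_pow, div_pow, Real.sq_sqrt hD.le]
    field_simp
    ring
  rw [h, Real.sqrt_sq (by positivity), div_div_div_cancel_right₀ (Real.sqrt_pos.2 hD).ne']

theorem stmt_0 (N : ℕ) (hN : 3 ≤ N) (R : ℝ) (hR : 0 < R)
    (F : ℝ → ℝ)
    (hF : ∀ ρ : ℝ,
      F ρ = ρ ^ ((1 : ℝ) - N) / Real.sqrt (R ^ ((2 : ℝ) - 2 * N) - ρ ^ ((2 : ℝ) - 2 * N)))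
    (v : ℝ → ℝ) (hv : ∀ r : ℝ, v r = ∫ ρ in Ioi r, F ρ) :
    ∀ r : ℝ, R < r →
      IntegrableOn F (Ioi r) volume ∧
      0 < v r ∧
      HasDerivAt v (-(F r)) r ∧
      r ^ ((N : ℝ) - 1) * deriv v r / Real.sqrt (1 + (deriv v r) ^ 2) =
        -(R ^ ((N : ℝ) - 1)) := by
  have hN' : (3 : ℝ) ≤ N := by exact_mod_cast hN
  have hgap : ∀ ρ, R < ρ → 0 < R ^ ((2 : ℝ) - 2 * N) - ρ ^ ((2 : ℝ) - 2 * N) := fun ρ hρ =>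
    sub_pos.2 (Real.rpow_lt_rpow_of_neg hR hρ (by linarith))
  have hpos : ∀ ρ, R < ρ → 0 < F ρ := fun ρ hρ => by
    rw [hF]
    exact div_pos (Real.rpow_pos_of_pos (hR.trans hρ) _) (Real.sqrt_pos.2 (hgap ρ hρ))
  have hcont : ∀ ρ, R < ρ → ContinuousAt F ρ := fun ρ hρ => by
    have hρ0 : ρ ≠ 0 := (hR.trans hρ).ne'
    rw [funext hF]
    exact (Real.continuousAt_rpow_const _ _ (Or.inl hρ0)).div
      (continuousAt_const.sub (Real.continuousAt_rpow_const _ _ (Or.inl hρ0))).sqrt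
      (Real.sqrt_pos.2 (hgap ρ hρ)).ne'
  have hint : ∀ r, R < r → IntegrableOn F (Ioi r) := fun r hr => by
    refine ((integrableOn_Ioi_rpow_of_lt (by linarith : (1 : ℝ) - N < -1)
      (hR.trans hr)).div_const (√(R ^ ((2 : ℝ) - 2 * N) - r ^ ((2 : ℝ) - 2 * N)))).mono'
      (ContinuousOn.aestronglyMeasurable
        (fun ρ hρ => (hcont ρ (hr.trans hρ)).continuousWithinAt) measurableSet_Ioi) ?_
    filter_upwards [ae_restrict_mem measurableSet_Ioi] with ρ hρ
    have hrρ : r < ρ := hρ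
    rw [Real.norm_of_nonneg (hpos ρ (hr.trans hrρ)).le, hF]
    refine div_le_div_of_nonneg_left (Real.rpow_nonneg (hR.trans (hr.trans hrρ)).le _)
      (Real.sqrt_pos.2 (hgap r hr)) (Real.sqrt_le_sqrt (sub_le_sub_left ?_ _))
    exact Real.rpow_le_rpow_of_nonpos (hR.trans hr) hrρ.le (by linarith)
  intro r hr
  have hderiv : HasDerivAt v (-(F r)) r := by
    obtain ⟨a, hRa, har⟩ := exists_between hr
    rw [funext hv]
    exact hasDerivAt_integral_Ioi har (hint a hRa) (hcont r hr)
  refine ⟨hint r hr, ?_, hderiv, ?_⟩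
  · rw [hv, setIntegral_pos_iff_support_of_nonneg_ae _ (hint r hr)]
    · have hsub : Ioi r ⊆ Function.support F ∩ Ioi r := fun ρ hρ =>
        ⟨(hpos ρ (hr.trans hρ)).ne', hρ⟩
      refine lt_of_lt_of_le ?_ (measure_mono hsub)
      simp
    · filter_upwards [ae_restrict_mem measurableSet_Ioi] with ρ hρ
      exact (hpos ρ (hr.trans hρ)).le
  · have hr0 : 0 < r := hR.trans hr
    have hquot := div_sqrt_one_add_div_sqrt_sq (Real.rpow_pos_of_pos hr0 ((1 : ℝ) - N))
      (Real.rpow_lt_rpow_of_neg hR hr (by linarith))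
    rw [← rpow_two_sub_two_mul_eq_sq hR, ← rpow_two_sub_two_mul_eq_sq hr0, ← hF] at hquot
    rw [hderiv.deriv, neg_sq, mul_neg, neg_div, mul_div_assoc, hquot, ← mul_div_assoc,
      ← Real.rpow_add hr0, show (N : ℝ) - 1 + (1 - N) = 0 by ring, Real.rpow_zero, one_div,
      ← Real.rpow_neg hR.le, neg_sub]
end

section
/- lim_{r→∞} r^{N−2} v_R(r) = R^{N−1}/(N−2); that is, v_R(r) = c r^{2−N}(1+o(1)) as r → ∞ with c = R^{N−1}/(N−2). -/
open MeasureTheory Filter Set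

/-- If `g` tends to `L` at infinity, the tail integral of `t ^ a * g t` is asymptotic to `L` times
the tail integral of `t ^ a`. -/
theorem tendsto_rpow_mul_integral_Ioi_rpow_mul {a L : ℝ} (ha : a < -1) {g : ℝ → ℝ}
    (hgm : Measurable g) (hg : Tendsto g atTop (nhds L)) :
    Tendsto (fun r : ℝ => r ^ (-(a + 1)) * ∫ t in Ioi r, t ^ a * g t) atTop
      (nhds (L / -(a + 1))) := by
  have ha' : 0 < -(a + 1) := by linarith
  rw [Metric.tendsto_atTop] at hg ⊢
  intro ε hε
  obtain ⟨M, hM⟩ := hg (ε * -(a + 1) / 2) (by positivity)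
  refine ⟨max M 1, fun r hr => ?_⟩
  have hr0 : 0 < r := by linarith [(le_max_right M 1).trans hr]
  have hrM : M ≤ r := (le_max_left M 1).trans hr
  have hint : IntegrableOn (fun t : ℝ => t ^ a) (Ioi r) := integrableOn_Ioi_rpow_of_lt ha hr0
  have hbound : ∀ᵐ t ∂volume.restrict (Ioi r),
      ‖t ^ a * (g t - L)‖ ≤ ε * -(a + 1) / 2 * t ^ a := by
    refine (ae_restrict_mem measurableSet_Ioi).mono fun t ht => ?_
    have hta : 0 ≤ t ^ a := Real.rpow_nonneg (hr0.trans ht).le a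
    have hd : |g t - L| ≤ ε * -(a + 1) / 2 := by
      simpa only [Real.dist_eq] using (hM t (hrM.trans (le_of_lt ht))).le
    rw [norm_mul, Real.norm_eq_abs, Real.norm_eq_abs, abs_of_nonneg hta, mul_comm]
    exact mul_le_mul_of_nonneg_right hd hta
  have hmeas : Measurable fun t : ℝ => t ^ a * (g t - L) := by fun_prop
  have hint' : IntegrableOn (fun t : ℝ => t ^ a * (g t - L)) (Ioi r) :=
    (hint.const_mul _).mono' hmeas.aestronglyMeasurable hbound
  have hle := norm_integral_le_of_norm_le (hint.const_mul _) hbound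
  have hsplit : ∫ t in Ioi r, t ^ a * g t =
      (∫ t in Ioi r, t ^ a * (g t - L)) + L * ∫ t in Ioi r, t ^ a := by
    rw [← integral_const_mul, ← integral_add hint' (hint.const_mul L)]
    congr 1 with t
    ring
  have hmul : r ^ (-(a + 1)) * r ^ (a + 1) = 1 := by
    rw [← Real.rpow_add hr0]; simp
  have hpos : 0 < r ^ (-(a + 1)) := Real.rpow_pos_of_pos hr0 _
  have htail : r ^ (-(a + 1)) * ∫ t in Ioi r, t ^ a = 1 / -(a + 1) := by
    rw [integral_Ioi_rpow_of_lt ha hr0, mul_div_assoc', mul_neg, hmul, neg_div, div_neg]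
  rw [integral_const_mul, Real.norm_eq_abs] at hle
  have hdiff : r ^ (-(a + 1)) * (∫ t in Ioi r, t ^ a * g t) - L / -(a + 1) =
      r ^ (-(a + 1)) * ∫ t in Ioi r, t ^ a * (g t - L) := by
    rw [hsplit]
    linear_combination L * htail
  rw [Real.dist_eq, hdiff, abs_mul, abs_of_pos hpos]
  calc r ^ (-(a + 1)) * |∫ t in Ioi r, t ^ a * (g t - L)|
      ≤ r ^ (-(a + 1)) * (ε * -(a + 1) / 2 * ∫ t in Ioi r, t ^ a) :=
        mul_le_mul_of_nonneg_left hle hpos.le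
    _ = ε * -(a + 1) / 2 * (1 / -(a + 1)) := by rw [← htail]; ring
    _ = ε / 2 := by rw [mul_one_div, mul_div_right_comm, mul_div_cancel_right₀ _ ha'.ne']
    _ < ε := half_lt_self hε

theorem stmt_3 (N : ℕ) (hN : 3 ≤ N) (R : ℝ) (hR : 0 < R)
    (F : ℝ → ℝ)
    (hF : ∀ ρ : ℝ,
      F ρ = ρ ^ ((1 : ℝ) - N) / Real.sqrt (R ^ ((2 : ℝ) - 2 * N) - ρ ^ ((2 : ℝ) - 2 * N)))
    (v : ℝ → ℝ) (hv : ∀ r : ℝ, v r = ∫ ρ in Ioi r, F ρ) :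
    Tendsto (fun r : ℝ => r ^ ((N : ℝ) - 2) * v r) atTop
      (nhds (R ^ ((N : ℝ) - 1) / ((N : ℝ) - 2))) := by
  have hN' : (3 : ℝ) ≤ N := by exact_mod_cast hN
  have hsqrt : Real.sqrt (R ^ ((2 : ℝ) - 2 * N)) = R ^ ((1 : ℝ) - N) := by
    rw [Real.sqrt_eq_rpow, ← Real.rpow_mul hR.le]
    congr 1
    ring
  have hpow : Tendsto (fun ρ : ℝ => ρ ^ ((2 : ℝ) - 2 * N)) atTop (nhds 0) := by
    have h := tendsto_rpow_neg_atTop (y := 2 * (N : ℝ) - 2) (by linarith)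
    rwa [neg_sub] at h
  have hg : Tendsto
      (fun ρ : ℝ => (Real.sqrt (R ^ ((2 : ℝ) - 2 * N) - ρ ^ ((2 : ℝ) - 2 * N)))⁻¹) atTop
      (nhds (R ^ ((N : ℝ) - 1))) := by
    have h := ((hpow.const_sub (R ^ ((2 : ℝ) - 2 * N))).sqrt).inv₀
      (by rw [sub_zero, hsqrt]; exact (Real.rpow_pos_of_pos hR _).ne')
    rwa [sub_zero, hsqrt, ← Real.rpow_neg hR.le, neg_sub] at h
  have key := tendsto_rpow_mul_integral_Ioi_rpow_mul (a := 1 - N) (by linarith)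
    (by fun_prop) hg
  have hexp : -((1 : ℝ) - N + 1) = N - 2 := by ring
  simpa only [hexp, hv, hF, div_eq_mul_inv] using key
end

section
/- lim_{r→∞} r^{N−2} · (v_R(r) − r v_R'(r))/√(1 + v_R'(r)²) = (N−1) R^{N−1}/(N−2). (This quantity is, in radial coordinates, the Jacobi field ζ₀(y) = y·ν_Σ(y) coming from dilations of the minimal graph Σ of u_R(x) = v_R(|x|); the limit shows ζ₀ decays exactly at the rate |y|^{2−N}, so the decay exponent ν̄ of ζ₀ equals 2−N and Σ is dilation-degenerate, which is the key computation in the proof of Theorem 1.2.) -/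
open MeasureTheory Filter Set

/-- If `L ≤ G ρ ≤ C` for all `ρ > r`, then `∫_r^∞ ρ ^ a * G ρ` is comparable with the
corresponding multiples of `∫_r^∞ ρ ^ a`. -/
lemma setIntegral_Ioi_rpow_mul_mem_Icc {a L C r : ℝ} {G : ℝ → ℝ} (ha : a < -1) (hr : 0 < r)
    (hL : 0 ≤ L) (hG : Measurable G) (hGL : ∀ ρ, r < ρ → L ≤ G ρ) (hGC : ∀ ρ, r < ρ → G ρ ≤ C) :
    r ^ (-(a + 1)) * ∫ ρ in Ioi r, ρ ^ a * G ρ ∈ Icc (L / (-(a + 1))) (C / (-(a + 1))) := by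
  have hint : IntegrableOn (fun ρ : ℝ => ρ ^ a) (Ioi r) := integrableOn_Ioi_rpow_of_lt ha hr
  have hlo : ∀ ρ ∈ Ioi r, ρ ^ a * L ≤ ρ ^ a * G ρ := fun ρ hρ =>
    mul_le_mul_of_nonneg_left (hGL ρ hρ) (Real.rpow_nonneg (hr.trans hρ).le a)
  have hhi : ∀ ρ ∈ Ioi r, ρ ^ a * G ρ ≤ ρ ^ a * C := fun ρ hρ =>
    mul_le_mul_of_nonneg_left (hGC ρ hρ) (Real.rpow_nonneg (hr.trans hρ).le a)
  have hintG : IntegrableOn (fun ρ : ℝ => ρ ^ a * G ρ) (Ioi r) := by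
    refine Integrable.mono' (hint.mul_const C)
      (hint.aestronglyMeasurable.mul hG.aestronglyMeasurable) ?_
    refine (ae_restrict_iff' measurableSet_Ioi).2 (Eventually.of_forall fun ρ hρ => ?_)
    rw [Real.norm_of_nonneg]
    · exact hhi ρ hρ
    · exact mul_nonneg (Real.rpow_nonneg (hr.trans hρ).le a) (hL.trans (hGL ρ hρ))
  have h1 := setIntegral_mono_on (hint.mul_const L) hintG measurableSet_Ioi hlo
  have h2 := setIntegral_mono_on hintG (hint.mul_const C) measurableSet_Ioi hhi
  rw [integral_mul_const, integral_Ioi_rpow_of_lt ha hr] at h1 h2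
  have hpos : 0 < r ^ (-(a + 1)) := Real.rpow_pos_of_pos hr _
  have hcancel : r ^ (-(a + 1)) * r ^ (a + 1) = 1 := by
    rw [← Real.rpow_add hr]; simp
  have key : ∀ c : ℝ, r ^ (-(a + 1)) * (-r ^ (a + 1) / (a + 1) * c) = c / (-(a + 1)) := fun c => by
    calc _ = (r ^ (-(a + 1)) * r ^ (a + 1)) * (c / (-(a + 1))) := by rw [div_neg]; ring
      _ = _ := by rw [hcancel, one_mul]
  rw [← key L, ← key C]
  exact ⟨mul_le_mul_of_nonneg_left h1 hpos.le, mul_le_mul_of_nonneg_left h2 hpos.le⟩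

theorem stmt_5 (N : ℕ) (hN : 3 ≤ N) (R : ℝ) (hR : 0 < R)
    (F : ℝ → ℝ)
    (hF : ∀ ρ : ℝ,
      F ρ = ρ ^ ((1 : ℝ) - N) / Real.sqrt (R ^ ((2 : ℝ) - 2 * N) - ρ ^ ((2 : ℝ) - 2 * N)))
    (v : ℝ → ℝ) (hv : ∀ r : ℝ, v r = ∫ ρ in Ioi r, F ρ)
    (hv' : ∀ r : ℝ, R < r → HasDerivAt v (-(F r)) r) :
    Tendsto
      (fun r : ℝ =>
        r ^ ((N : ℝ) - 2) * ((v r - r * deriv v r) / Real.sqrt (1 + (deriv v r) ^ 2)))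
      atTop (nhds (((N : ℝ) - 1) * R ^ ((N : ℝ) - 1) / ((N : ℝ) - 2))) := by
  have hN' : (3 : ℝ) ≤ N := by exact_mod_cast hN
  set L : ℝ := R ^ ((N : ℝ) - 1) with hL
  have hLpos : 0 < L := Real.rpow_pos_of_pos hR _
  let G : ℝ → ℝ := fun ρ => (Real.sqrt (R ^ ((2 : ℝ) - 2 * N) - ρ ^ ((2 : ℝ) - 2 * N)))⁻¹
  have hFG : ∀ ρ, F ρ = ρ ^ ((1 : ℝ) - N) * G ρ := fun ρ => by rw [hF, div_eq_mul_inv]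
  have hsqrt : Real.sqrt (R ^ ((2 : ℝ) - 2 * N)) = L⁻¹ := by
    rw [Real.sqrt_eq_rpow, ← Real.rpow_mul hR.le, hL, ← Real.rpow_neg hR.le]
    congr 1; ring
  have hGmeas : Measurable G := by fun_prop
  have hpow : Tendsto (fun r : ℝ => r ^ ((2 : ℝ) - 2 * N)) atTop (nhds 0) := by
    have := tendsto_rpow_neg_atTop (y := 2 * (N : ℝ) - 2) (by linarith)
    simpa using this
  have hGlim : Tendsto G atTop (nhds L) := by
    have h := ((tendsto_const_nhds (x := R ^ ((2 : ℝ) - 2 * N))).sub hpow).sqrt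
    rw [sub_zero, hsqrt] at h
    simpa using h.inv₀ (inv_ne_zero hLpos.ne')
  have hdiff : ∀ r, R < r → 0 < R ^ ((2 : ℝ) - 2 * N) - r ^ ((2 : ℝ) - 2 * N) := fun r hr =>
    sub_pos.2 (Real.rpow_lt_rpow_of_neg hR hr (by linarith))
  have hGL : ∀ r, R < r → L ≤ G r := fun r hr => by
    rw [← inv_inv L, ← hsqrt]
    refine inv_anti₀ (Real.sqrt_pos.2 (hdiff r hr)) (Real.sqrt_le_sqrt ?_)
    have := Real.rpow_nonneg (hR.trans hr).le ((2 : ℝ) - 2 * N)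
    linarith
  have hGanti : ∀ r, R < r → ∀ ρ, r < ρ → G ρ ≤ G r := fun r hr ρ hρ => by
    refine inv_anti₀ (Real.sqrt_pos.2 (hdiff r hr)) (Real.sqrt_le_sqrt ?_)
    have := Real.rpow_lt_rpow_of_neg (z := (2 : ℝ) - 2 * N) (hR.trans hr) hρ (by linarith)
    linarith
  have hexp : -((1 : ℝ) - N + 1) = (N : ℝ) - 2 := by ring
  have hvmem : ∀ r, R < r →
      r ^ ((N : ℝ) - 2) * v r ∈ Icc (L / ((N : ℝ) - 2)) (G r / ((N : ℝ) - 2)) := fun r hr => by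
    have := setIntegral_Ioi_rpow_mul_mem_Icc (a := (1 : ℝ) - N) (by linarith) (hR.trans hr)
      hLpos.le hGmeas (fun ρ hρ => hGL ρ (hr.trans hρ)) (hGanti r hr)
    rw [hexp] at this
    simpa only [hv, hFG] using this
  have hvlim : Tendsto (fun r => r ^ ((N : ℝ) - 2) * v r) atTop (nhds (L / ((N : ℝ) - 2))) :=
    tendsto_of_tendsto_of_tendsto_of_le_of_le' tendsto_const_nhds (hGlim.div_const _)
      ((eventually_gt_atTop R).mono fun r hr => (hvmem r hr).1)
      ((eventually_gt_atTop R).mono fun r hr => (hvmem r hr).2)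
  have hFlim : Tendsto F atTop (nhds 0) := by
    have h := (tendsto_rpow_neg_atTop (y := (N : ℝ) - 1) (by linarith)).mul hGlim
    rw [zero_mul] at h
    refine h.congr fun r => ?_
    rw [hFG, neg_sub]
  have hden : Tendsto (fun r => Real.sqrt (1 + F r ^ 2)) atTop (nhds 1) := by
    simpa using ((hFlim.pow 2).const_add 1).sqrt
  have hlim := (hvlim.add hGlim).div hden one_ne_zero
  have hval : (L / ((N : ℝ) - 2) + L) / 1 = ((N : ℝ) - 1) * L / ((N : ℝ) - 2) := by
    have : (N : ℝ) - 2 ≠ 0 := by linarith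
    field_simp
    ring
  rw [hval] at hlim
  refine hlim.congr' ((eventually_gt_atTop R).mono fun r hr => ?_)
  have hr0 : 0 < r := hR.trans hr
  have hG : r ^ ((N : ℝ) - 2) * (r * F r) = G r := by
    have h1 : r ^ ((N : ℝ) - 2) * r * r ^ ((1 : ℝ) - N) = 1 := by
      rw [← Real.rpow_add_one hr0.ne', ← Real.rpow_add hr0]
      ring_nf
      simp
    rw [hFG, ← mul_assoc, ← mul_assoc, h1, one_mul]
  simp only [Pi.div_apply, (hv' r hr).deriv, neg_sq]
  rw [← hG]
  ring
end

section
/- One has v_R(r) ≥ (R^{N−1}/(N−2)) r^{2−N} for every r > R, and there exists a constant C > 0 such that v_R(r) ≤ C r^{2−N} for every r > R. Hence the decay rate r^{2−N} of the radial profile of the exterior minimal graph is sharp. -/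
open MeasureTheory Filter Set

lemma rpow_mul_rpow_neg_lt_one {R a ρ : ℝ} (hR : 0 < R) (ha : 0 < a) (h : R < ρ) :
    R ^ a * ρ ^ (-a) < 1 := by
  rw [Real.rpow_neg (hR.trans h).le, ← div_eq_mul_inv,
    div_lt_one (Real.rpow_pos_of_pos (hR.trans h) a)]
  exact Real.rpow_lt_rpow hR.le h ha

/-- An explicit primitive of a majorant of the slope of the exterior minimal graph. -/
lemma hasDerivAt_sqrt_one_sub_rpow {R a ρ : ℝ} (hR : 0 < R) (ha : 0 < a) (h : R < ρ) :
    HasDerivAt (fun x => 2 * R / a * Real.sqrt (1 - R ^ a * x ^ (-a)))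
      (R ^ (a + 1) * ρ ^ (-a - 1) / Real.sqrt (1 - R ^ a * ρ ^ (-a))) ρ := by
  have h1 := sub_pos.2 (rpow_mul_rpow_neg_lt_one hR ha h)
  have h2 := ((((Real.hasDerivAt_rpow_const (p := -a)
    (Or.inl (hR.trans h).ne')).const_mul (R ^ a)).const_sub 1).sqrt h1.ne').const_mul (2 * R / a)
  refine h2.congr_deriv ?_
  have := (Real.sqrt_pos.2 h1).ne'
  rw [Real.rpow_add_one hR.ne']
  field_simp

lemma tendsto_sqrt_one_sub_rpow_atTop (R : ℝ) {a : ℝ} (ha : 0 < a) :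
    Tendsto (fun x => 2 * R / a * Real.sqrt (1 - R ^ a * x ^ (-a))) atTop (nhds (2 * R / a)) := by
  simpa using ((((tendsto_rpow_neg_atTop ha).const_mul (R ^ a)).const_sub 1).sqrt).const_mul
    (2 * R / a)

lemma rpow_div_sqrt_rpow_sub_rpow {R : ℝ} (hR : 0 < R) (ρ a : ℝ) :
    ρ ^ (-a - 1) / Real.sqrt (R ^ (-2 * a - 2) - ρ ^ (-2 * a - 2)) =
      R ^ (a + 1) * ρ ^ (-a - 1) / Real.sqrt (1 - R ^ (2 * a + 2) * ρ ^ (-(2 * a + 2))) := by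
  have h1 : R ^ (-2 * a - 2) - ρ ^ (-2 * a - 2) =
      (R ^ (-(a + 1))) ^ 2 * (1 - R ^ (2 * a + 2) * ρ ^ (-(2 * a + 2))) := by
    rw [← Real.rpow_mul_natCast hR.le, mul_sub, mul_one, ← mul_assoc, ← Real.rpow_add hR]
    push_cast
    ring_nf
    simp
  have hp := Real.rpow_pos_of_pos hR (a + 1)
  rw [h1, Real.sqrt_mul (sq_nonneg _), Real.sqrt_sq (Real.rpow_nonneg hR.le _),
    Real.rpow_neg hR.le]
  field_simp

theorem stmt_6 (N : ℕ) (hN : 3 ≤ N) (R : ℝ) (hR : 0 < R)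
    (F : ℝ → ℝ)
    (hF : ∀ ρ : ℝ,
      F ρ = ρ ^ ((1 : ℝ) - N) / Real.sqrt (R ^ ((2 : ℝ) - 2 * N) - ρ ^ ((2 : ℝ) - 2 * N)))
    (v : ℝ → ℝ) (hv : ∀ r : ℝ, v r = ∫ ρ in Ioi r, F ρ) :
    (∀ r : ℝ, R < r → R ^ ((N : ℝ) - 1) / ((N : ℝ) - 2) * r ^ ((2 : ℝ) - N) ≤ v r) ∧
    ∃ C : ℝ, 0 < C ∧ ∀ r : ℝ, R < r → v r ≤ C * r ^ ((2 : ℝ) - N) := by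
  obtain ⟨a, ha⟩ : ∃ a : ℝ, a = (N : ℝ) - 2 := ⟨_, rfl⟩
  have hN' : (3 : ℝ) ≤ N := by exact_mod_cast hN
  have ha0 : 0 < a := by linarith
  have hF' : ∀ ρ, R < ρ → F ρ =
      R ^ (a + 1) * ρ ^ (-a - 1) / Real.sqrt (1 - R ^ (2 * a + 2) * ρ ^ (-(2 * a + 2))) := by
    intro ρ h
    rw [hF, ← rpow_div_sqrt_rpow_sub_rpow hR, ha]
    ring_nf
  rw [← ha, show (N : ℝ) - 1 = a + 1 by linarith, show (2 : ℝ) - N = -a by linarith]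
  have hnum : ∀ ρ, R < ρ → 0 ≤ R ^ (a + 1) * ρ ^ (-a - 1) := fun ρ h =>
    mul_nonneg (Real.rpow_nonneg hR.le _) (Real.rpow_nonneg (hR.trans h).le _)
  have hlow : ∀ ρ, R < ρ → R ^ (a + 1) * ρ ^ (-a - 1) ≤ F ρ := by
    intro ρ h
    rw [hF' ρ h]
    refine le_div_self (hnum ρ h)
      (Real.sqrt_pos.2 (sub_pos.2 (rpow_mul_rpow_neg_lt_one hR (by linarith) h))) ?_
    refine Real.sqrt_le_one.2 (sub_le_self _ ?_)
    exact mul_nonneg (Real.rpow_nonneg hR.le _) (Real.rpow_nonneg (hR.trans h).le _)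
  have hup : ∀ ρ, R < ρ →
      F ρ ≤ R ^ (a + 1) * ρ ^ (-a - 1) / Real.sqrt (1 - R ^ a * ρ ^ (-a)) := by
    intro ρ h
    rw [hF' ρ h]
    refine div_le_div_of_nonneg_left (hnum ρ h)
      (Real.sqrt_pos.2 (sub_pos.2 (rpow_mul_rpow_neg_lt_one hR ha0 h))) ?_
    refine Real.sqrt_le_sqrt (sub_le_sub_left ?_ 1)
    have hρ := hR.trans h
    rw [Real.rpow_neg hρ.le, Real.rpow_neg hρ.le, ← div_eq_mul_inv, ← div_eq_mul_inv,
      ← Real.div_rpow hR.le hρ.le, ← Real.div_rpow hR.le hρ.le]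
    exact Real.rpow_le_rpow_of_exponent_ge (div_pos hR hρ) ((div_le_one hρ).2 h.le)
      (by linarith)
  have hderiv : ∀ r, R < r → ∀ x ∈ Ici r, HasDerivAt _ _ x := fun r hr x hx =>
    hasDerivAt_sqrt_one_sub_rpow hR ha0 (hr.trans_le hx)
  have hnonneg : ∀ r, R < r → ∀ x ∈ Ioi r,
      0 ≤ R ^ (a + 1) * x ^ (-a - 1) / Real.sqrt (1 - R ^ a * x ^ (-a)) := fun r hr x hx =>
    div_nonneg (hnum x (hr.trans hx)) (Real.sqrt_nonneg _)
  have hint : ∀ r, R < r → IntegrableOn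
      (fun x => R ^ (a + 1) * x ^ (-a - 1) / Real.sqrt (1 - R ^ a * x ^ (-a))) (Ioi r) :=
    fun r hr => integrableOn_Ioi_deriv_of_nonneg' (hderiv r hr) (hnonneg r hr)
      (tendsto_sqrt_one_sub_rpow_atTop R ha0)
  have hFint : ∀ r, R < r → IntegrableOn F (Ioi r) := by
    intro r hr
    have hm : Measurable F := by
      rw [funext hF]
      fun_prop
    refine (hint r hr).mono' hm.aestronglyMeasurable ?_
    filter_upwards [ae_restrict_mem measurableSet_Ioi] with x hx
    rw [Real.norm_of_nonneg ((hnum x (hr.trans hx)).trans (hlow x (hr.trans hx)))]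
    exact hup x (hr.trans hx)
  refine ⟨fun r hr => ?_, 2 * R / a * R ^ a, by positivity, fun r hr => ?_⟩
  · have hr0 := hR.trans hr
    have hexp : -a - 1 < -1 := by linarith
    calc R ^ (a + 1) / a * r ^ (-a) = ∫ x in Ioi r, R ^ (a + 1) * x ^ (-a - 1) := by
          rw [integral_const_mul, integral_Ioi_rpow_of_lt hexp hr0, sub_add_cancel]
          field_simp
      _ ≤ v r := by
          rw [hv]
          exact setIntegral_mono_on ((integrableOn_Ioi_rpow_of_lt hexp hr0).const_mul _)
            (hFint r hr) measurableSet_Ioi fun x hx => hlow x (hr.trans hx)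
  · have hu := rpow_mul_rpow_neg_lt_one hR ha0 hr
    have hu0 : 0 ≤ R ^ a * r ^ (-a) :=
      mul_nonneg (Real.rpow_nonneg hR.le _) (Real.rpow_nonneg (hR.trans hr).le _)
    calc v r ≤ ∫ x in Ioi r, R ^ (a + 1) * x ^ (-a - 1) / Real.sqrt (1 - R ^ a * x ^ (-a)) := by
          rw [hv]
          exact setIntegral_mono_on (hFint r hr) (hint r hr) measurableSet_Ioi
            fun x hx => hup x (hr.trans hx)
      _ = 2 * R / a - 2 * R / a * Real.sqrt (1 - R ^ a * r ^ (-a)) :=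
          integral_Ioi_of_hasDerivAt_of_nonneg' (hderiv r hr) (hnonneg r hr)
            (tendsto_sqrt_one_sub_rpow_atTop R ha0)
      _ = 2 * R / a * (1 - Real.sqrt (1 - R ^ a * r ^ (-a))) := by ring
      _ ≤ 2 * R / a * (R ^ a * r ^ (-a)) := by
          refine mul_le_mul_of_nonneg_left ?_ (by positivity)
          have : 1 - R ^ a * r ^ (-a) ≤ Real.sqrt (1 - R ^ a * r ^ (-a)) :=
            Real.le_sqrt_of_sq_le (by nlinarith)
          linarith
      _ = 2 * R / a * R ^ a * r ^ (-a) := by ring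
end

section
/- v_R is twice differentiable on (R,∞) and v_R''(r) > 0 for every r > R; consequently the radial function u_R(x) := v_R(|x|) is strictly convex in the radial direction (this is the fact used to show that u_R is a positive subharmonic function on the exterior domain). -/
open MeasureTheory Filter Set

/-- For negative exponents `a` and `b`, the function `x ↦ x ^ a / √(R ^ b - x ^ b)` has a negative
derivative at every point `r > R > 0`. -/
theorem exists_neg_hasDerivAt_rpow_div_sqrt {a b R r : ℝ} (ha : a < 0) (hb : b < 0) (hR : 0 < R)
    (hr : R < r) :
    ∃ d < 0, HasDerivAt (fun x : ℝ => x ^ a / Real.sqrt (R ^ b - x ^ b)) d r := by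
  have hr0 : 0 < r := hR.trans hr
  have hD : 0 < R ^ b - r ^ b := sub_pos.2 (Real.rpow_lt_rpow_of_neg hR hr hb)
  have hs : 0 < Real.sqrt (R ^ b - r ^ b) := Real.sqrt_pos.2 hD
  have hnum : HasDerivAt (fun x : ℝ => x ^ a) (a * r ^ (a - 1)) r :=
    Real.hasDerivAt_rpow_const (Or.inl hr0.ne')
  have hden : HasDerivAt (fun x : ℝ => Real.sqrt (R ^ b - x ^ b))
      (-(b * r ^ (b - 1)) / (2 * Real.sqrt (R ^ b - r ^ b))) r :=
    ((Real.hasDerivAt_rpow_const (Or.inl hr0.ne')).const_sub _).sqrt hD.ne'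
  refine ⟨_, ?_, hnum.div hden hs.ne'⟩
  have hnum_neg : a * r ^ (a - 1) < 0 := mul_neg_of_neg_of_pos ha (Real.rpow_pos_of_pos hr0 _)
  have hden_pos : 0 < -(b * r ^ (b - 1)) / (2 * Real.sqrt (R ^ b - r ^ b)) :=
    div_pos (neg_pos.2 (mul_neg_of_neg_of_pos hb (Real.rpow_pos_of_pos hr0 _))) (by positivity)
  refine div_neg_of_neg_of_pos ?_ (by positivity)
  linarith [mul_neg_of_neg_of_pos hnum_neg hs, mul_pos (Real.rpow_pos_of_pos hr0 a) hden_pos]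

theorem stmt_8 (N : ℕ) (hN : 3 ≤ N) (R : ℝ) (hR : 0 < R)
    (F : ℝ → ℝ)
    (hF : ∀ ρ : ℝ,
      F ρ = ρ ^ ((1 : ℝ) - N) / Real.sqrt (R ^ ((2 : ℝ) - 2 * N) - ρ ^ ((2 : ℝ) - 2 * N)))
    (v : ℝ → ℝ) (hv : ∀ r : ℝ, v r = ∫ ρ in Ioi r, F ρ)
    (hv' : ∀ r : ℝ, R < r → HasDerivAt v (-(F r)) r) :
    ∀ r : ℝ, R < r → DifferentiableAt ℝ (deriv v) r ∧ 0 < deriv (deriv v) r := by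
  intro r hr
  have hN' : (3 : ℝ) ≤ N := by exact_mod_cast hN
  obtain ⟨d, hd, hder⟩ := exists_neg_hasDerivAt_rpow_div_sqrt
    (a := 1 - N) (b := 2 - 2 * N) (by linarith) (by linarith) hR hr
  rw [← funext hF] at hder
  have hv'' : HasDerivAt (deriv v) (-d) r := by
    refine hder.neg.congr_of_eventuallyEq ?_
    filter_upwards [Ioi_mem_nhds hr] with x hx
    exact (hv' x hx).deriv
  exact ⟨hv''.differentiableAt, hv''.deriv.symm ▸ neg_pos.2 hd⟩
end

section
/- There exists a constant C > 0 such that ‖Ku‖_Z ≤ C ‖Au‖_H for every u ∈ W that is H-orthogonal to ker A. -/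
open scoped RealInnerProductSpace

/-- Under an a priori estimate `‖u‖ ≤ C₀ * (‖A u‖ + ‖K u‖)`, the map `u ↦ (A u, K u)` is a closed
embedding. -/
lemma isClosedEmbedding_prod_of_norm_le {W H Z : Type*}
    [NormedAddCommGroup W] [NormedSpace ℝ W] [CompleteSpace W]
    [NormedAddCommGroup H] [NormedSpace ℝ H] [NormedAddCommGroup Z] [NormedSpace ℝ Z]
    (A : W →L[ℝ] H) (K : W →L[ℝ] Z) {C₀ : ℝ} (hC₀ : 0 ≤ C₀)
    (hapr : ∀ u : W, ‖u‖ ≤ C₀ * (‖A u‖ + ‖K u‖)) :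
    Topology.IsClosedEmbedding (A.prod K) := by
  have hanti : AntilipschitzWith (C₀ * 2).toNNReal (A.prod K) := by
    refine (A.prod K).antilipschitz_of_bound fun u => (hapr u).trans ?_
    rw [Real.coe_toNNReal _ (by positivity), mul_assoc]
    have hA : ‖A u‖ ≤ ‖A.prod K u‖ := norm_fst_le (A.prod K u)
    have hK : ‖K u‖ ≤ ‖A.prod K u‖ := norm_snd_le (A.prod K u)
    gcongr
    linarith
  exact hanti.isClosedEmbedding (A.prod K).uniformContinuous

/-- If `K` is compact and `‖u‖ ≤ C₀ * (‖A u‖ + ‖K u‖)`, then `K` is bounded by `A` on every closed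
subspace meeting the kernel of `A` trivially. -/
lemma exists_norm_le_of_compact_of_apriori {W H Z : Type*}
    [NormedAddCommGroup W] [NormedSpace ℝ W] [CompleteSpace W]
    [NormedAddCommGroup H] [NormedSpace ℝ H] [NormedAddCommGroup Z] [NormedSpace ℝ Z]
    (A : W →L[ℝ] H) (K : W →L[ℝ] Z)
    (hK : ∀ s : Set W, Bornology.IsBounded s → IsCompact (closure (K '' s)))
    {C₀ : ℝ} (hC₀ : 0 ≤ C₀) (hapr : ∀ u : W, ‖u‖ ≤ C₀ * (‖A u‖ + ‖K u‖))
    (S : Submodule ℝ W) (hS : IsClosed (S : Set W)) (hker : ∀ u ∈ S, A u = 0 → u = 0) :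
    ∃ C : ℝ, 0 < C ∧ ∀ u ∈ S, ‖K u‖ ≤ C * ‖A u‖ := by
  by_contra! hcon
  have hseq : ∀ n : ℕ, ∃ w ∈ S, ‖K w‖ = 1 ∧ ‖A w‖ ≤ 1 / ((n : ℝ) + 1) := by
    intro n
    have hn : (0 : ℝ) < (n : ℝ) + 1 := by positivity
    obtain ⟨u, huS, hu⟩ := hcon _ hn
    have hpos : 0 < ‖K u‖ := lt_of_le_of_lt (by positivity) hu
    refine ⟨‖K u‖⁻¹ • u, S.smul_mem _ huS, ?_, ?_⟩
    · rw [map_smul, norm_smul, norm_inv, norm_norm, inv_mul_cancel₀ hpos.ne']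
    · rw [map_smul, norm_smul, norm_inv, norm_norm, inv_mul_eq_div, div_le_div_iff₀ hpos hn]
      linarith
  choose w hwS hwK hwA using hseq
  have hAlim : Filter.Tendsto (fun n => A (w n)) Filter.atTop (nhds 0) :=
    squeeze_zero_norm hwA tendsto_one_div_add_atTop_nhds_zero_nat
  have hbdd : Bornology.IsBounded (Set.range w) := by
    refine isBounded_iff_forall_norm_le.2 ⟨C₀ * 2, ?_⟩
    rintro _ ⟨n, rfl⟩
    have h1 : 1 / ((n : ℝ) + 1) ≤ 1 := by
      rw [div_le_one (by positivity)]
      linarith [(Nat.cast_nonneg n : (0 : ℝ) ≤ n)]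
    refine (hapr (w n)).trans ?_
    gcongr
    linarith [hwA n, hwK n]
  obtain ⟨z, -, φ, hφ, hz⟩ := (hK _ hbdd).tendsto_subseq
    (x := fun n => K (w n)) fun n => subset_closure ⟨w n, ⟨n, rfl⟩, rfl⟩
  have hemb := isClosedEmbedding_prod_of_norm_le A K hC₀ hapr
  have hlim : Filter.Tendsto (fun n => A.prod K (w (φ n))) Filter.atTop (nhds (0, z)) :=
    (hAlim.comp hφ.tendsto_atTop).prodMk_nhds hz
  obtain ⟨v, hv⟩ := hemb.isClosed_range.mem_of_tendsto hlim
    (Filter.Eventually.of_forall fun n => Set.mem_range_self _)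
  have hwv : Filter.Tendsto (fun n => w (φ n)) Filter.atTop (nhds v) := by
    rw [hemb.isInducing.tendsto_nhds_iff, hv]
    exact hlim
  have hvS : v ∈ S := hS.mem_of_tendsto hwv (Filter.Eventually.of_forall fun n => hwS _)
  have hv0 : v = 0 := hker v hvS (congrArg Prod.fst hv)
  have hz1 : ‖z‖ = 1 := tendsto_nhds_unique hz.norm (by simp [hwK])
  have hKv : K v = z := congrArg Prod.snd hv
  rw [← hKv, hv0, map_zero, norm_zero] at hz1
  exact zero_ne_one hz1



theorem stmt_12 {H W Z : Type*}
    [NormedAddCommGroup H] [InnerProductSpace ℝ H] [CompleteSpace H]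
    [NormedAddCommGroup W] [InnerProductSpace ℝ W] [CompleteSpace W]
    [NormedAddCommGroup Z] [NormedSpace ℝ Z] [CompleteSpace Z]
    (ι : W →L[ℝ] H) (hinj : Function.Injective (⇑ι)) (hdense : DenseRange (⇑ι))
    (A : W →L[ℝ] H) (K : W →L[ℝ] Z)
    (hK : ∀ s : Set W, Bornology.IsBounded s → IsCompact (closure (K '' s)))
    (C₀ : ℝ) (hC₀ : 0 < C₀) (hapr : ∀ u : W, ‖u‖ ≤ C₀ * (‖A u‖ + ‖K u‖)) :
    ∃ C : ℝ, 0 < C ∧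
      ∀ u : W, (∀ v : W, A v = 0 → ⟪ι u, ι v⟫ = 0) → ‖K u‖ ≤ C * ‖A u‖ := by
  let N : Submodule ℝ H := A.ker.map ι.toLinearMap
  have hmem : ∀ u : W, u ∈ Nᗮ.comap ι.toLinearMap ↔ ∀ v : W, A v = 0 → ⟪ι u, ι v⟫ = 0 := by
    intro u
    simp [N, Submodule.mem_orthogonal']
  obtain ⟨C, hC, hbound⟩ := exists_norm_le_of_compact_of_apriori A K hK hC₀.le hapr
    (Nᗮ.comap ι.toLinearMap) (N.isClosed_orthogonal.preimage ι.continuous) fun u hu hAu =>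
      hinj (by rw [map_zero, ← inner_self_eq_zero (𝕜 := ℝ)]; exact (hmem u).1 hu u hAu)
  exact ⟨C, hC, fun u hu => hbound u ((hmem u).2 hu)⟩
end

section
/- There exists a constant c > 0 such that ‖u‖_W ≤ c ‖Au‖_H for every u ∈ W that is H-orthogonal to ker A; consequently A restricted to the H-orthogonal complement of ker A in W is a topological isomorphism onto its image. -/
open scoped RealInnerProductSpace

open Filter Topology

/-- If `A` is bounded below modulo a compact operator `K`, then `A` is bounded below on every
closed subspace on which it is injective. -/
theorem ContinuousLinearMap.exists_norm_le_mul_of_norm_le_add_compact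
    {W H Z : Type*} [NormedAddCommGroup W] [NormedSpace ℝ W] [CompleteSpace W]
    [NormedAddCommGroup H] [NormedSpace ℝ H] [NormedAddCommGroup Z] [NormedSpace ℝ Z]
    (A : W →L[ℝ] H) (K : W →L[ℝ] Z)
    (hK : ∀ s : Set W, Bornology.IsBounded s → IsCompact (closure (K '' s)))
    {C : ℝ} (hC : 0 ≤ C) (hAK : ∀ u, ‖u‖ ≤ C * (‖A u‖ + ‖K u‖))
    (M : Submodule ℝ W) (hM : IsClosed (M : Set W)) (hA : ∀ u ∈ M, A u = 0 → u = 0) :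
    ∃ c : ℝ, 0 < c ∧ ∀ u ∈ M, ‖u‖ ≤ c * ‖A u‖ := by
  by_contra! h
  have hunit : ∀ n : ℕ, ∃ w ∈ M, ‖w‖ = 1 ∧ ‖A w‖ ≤ 1 / ((n : ℝ) + 1) := by
    intro n
    obtain ⟨u, hu, hlt⟩ := h ((n : ℝ) + 1) (by positivity)
    have hpos : 0 < ‖u‖ := lt_of_le_of_lt (by positivity) hlt
    refine ⟨‖u‖⁻¹ • u, M.smul_mem _ hu, ?_, ?_⟩
    · rw [norm_smul, norm_inv, norm_norm, inv_mul_cancel₀ hpos.ne']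
    · rw [map_smul, norm_smul, norm_inv, norm_norm, inv_mul_eq_div, div_le_div_iff₀ hpos
        (by positivity)]
      linarith
  choose w hwM hw1 hwA using hunit
  have hA0 : Tendsto (fun n => A (w n)) atTop (𝓝 0) :=
    squeeze_zero_norm hwA tendsto_one_div_add_atTop_nhds_zero_nat
  have hKmem : ∀ n, K (w n) ∈ closure (K '' Metric.closedBall 0 1) := fun n =>
    subset_closure ⟨w n, by simp [hw1 n], rfl⟩
  obtain ⟨z, -, φ, hφ, hz⟩ := (hK _ Metric.isBounded_closedBall).tendsto_subseq hKmem
  have hanti : AntilipschitzWith (2 * C).toNNReal (A.prod K) := by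
    refine AddMonoidHomClass.antilipschitz_of_bound _ fun u => ?_
    rw [Real.coe_toNNReal _ (by positivity)]
    have h1 : ‖A u‖ ≤ ‖A.prod K u‖ := le_max_left _ _
    have h2 : ‖K u‖ ≤ ‖A.prod K u‖ := le_max_right _ _
    nlinarith [hAK u]
  have hcauchy : CauchySeq (w ∘ φ) := by
    refine (hanti.isUniformInducing (A.prod K).uniformContinuous).cauchy_map_iff.mp ?_
    exact ((hA0.comp hφ.tendsto_atTop).prodMk_nhds hz).cauchySeq
  obtain ⟨x, hx⟩ := cauchySeq_tendsto_of_complete hcauchy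
  have hxM : x ∈ M := hM.mem_of_tendsto hx (Eventually.of_forall fun n => hwM (φ n))
  have hAx : A x = 0 :=
    tendsto_nhds_unique ((A.continuous.tendsto x).comp hx) (hA0.comp hφ.tendsto_atTop)
  have hx1 : ‖x‖ = 1 :=
    tendsto_nhds_unique hx.norm (by simp [hw1])
  simp [hA x hxM hAx] at hx1

theorem stmt_13 {H W Z : Type*}
    [NormedAddCommGroup H] [InnerProductSpace ℝ H] [CompleteSpace H]
    [NormedAddCommGroup W] [InnerProductSpace ℝ W] [CompleteSpace W]
    [NormedAddCommGroup Z] [NormedSpace ℝ Z] [CompleteSpace Z]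
    (ι : W →L[ℝ] H) (hinj : Function.Injective (⇑ι)) (hdense : DenseRange (⇑ι))
    (A : W →L[ℝ] H) (K : W →L[ℝ] Z)
    (hK : ∀ s : Set W, Bornology.IsBounded s → IsCompact (closure (K '' s)))
    (C₀ : ℝ) (hC₀ : 0 < C₀) (hapr : ∀ u : W, ‖u‖ ≤ C₀ * (‖A u‖ + ‖K u‖)) :
    (∃ c : ℝ, 0 < c ∧
      ∀ u : W, (∀ v : W, A v = 0 → ⟪ι u, ι v⟫ = 0) → ‖u‖ ≤ c * ‖A u‖) ∧
    ∀ u u' : W, (∀ v : W, A v = 0 → ⟪ι u, ι v⟫ = 0) →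
      (∀ v : W, A v = 0 → ⟪ι u', ι v⟫ = 0) → A u = A u' → u = u' := by
  let M : Submodule ℝ W := (A.ker.map (ι : W →ₗ[ℝ] H))ᗮ.comap (ι : W →ₗ[ℝ] H)
  have hmem : ∀ u, u ∈ M ↔ ∀ v : W, A v = 0 → ⟪ι u, ι v⟫ = 0 := fun u => by
    simp [M, Submodule.mem_orthogonal']
  have hMclosed : IsClosed (M : Set W) :=
    (Submodule.isClosed_orthogonal _).preimage ι.continuous
  have hM : ∀ u ∈ M, A u = 0 → u = 0 := fun u hu hAu =>
    hinj (by rw [map_zero]; exact inner_self_eq_zero.mp ((hmem u).mp hu u hAu))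
  refine ⟨?_, fun u u' hu hu' hAu => ?_⟩
  · simpa only [hmem] using
      A.exists_norm_le_mul_of_norm_le_add_compact K hK hC₀.le hapr M hMclosed hM
  · refine sub_eq_zero.mp (hM _ (M.sub_mem ((hmem u).mpr hu) ((hmem u').mpr hu')) ?_)
    rw [map_sub, hAu, sub_self]
end

section
/- The image A(W) is a closed subspace of H. More precisely, if g_k = A u_k with u_k ∈ W H-orthogonal to ker A and g_k → g in H, then u_k converges in W to some u with A u = g. -/
open Filter
open scoped RealInnerProductSpace Topology

/-- An injective continuous linear map satisfying an a priori estimate modulo a compact map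
is bounded below. -/
theorem exists_antilipschitzWith_of_apriori_estimate {E F Z : Type*}
    [NormedAddCommGroup E] [NormedSpace ℝ E] [CompleteSpace E]
    [NormedAddCommGroup F] [NormedSpace ℝ F]
    [NormedAddCommGroup Z] [NormedSpace ℝ Z]
    (T : E →L[ℝ] F) (K : E →L[ℝ] Z)
    (hK : ∀ s : Set E, Bornology.IsBounded s → IsCompact (closure (K '' s)))
    (C₀ : ℝ) (hapr : ∀ u : E, ‖u‖ ≤ C₀ * (‖T u‖ + ‖K u‖))
    (hT : Function.Injective T) : ∃ C, AntilipschitzWith C T := by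
  suffices h : ∃ n : ℕ, ∀ u : E, ‖u‖ ≤ n * ‖T u‖ by
    obtain ⟨n, hn⟩ := h
    exact ⟨n, T.antilipschitz_of_bound (K := (n : NNReal)) (by simpa using hn)⟩
  by_contra! h
  choose v hv using h
  have hv0 : ∀ n, 0 < ‖v n‖ := fun n ↦ lt_of_le_of_lt (by positivity) (hv n)
  let u : ℕ → E := fun n ↦ ‖v n‖⁻¹ • v n
  have hu : ∀ n, ‖u n‖ = 1 := fun n ↦ by
    simp [u, norm_smul, (hv0 n).ne']
  have hTu_le : ∀ n : ℕ, n * ‖T (u n)‖ ≤ 1 := fun n ↦ by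
    have : n * ‖T (u n)‖ = (n * ‖T (v n)‖) / ‖v n‖ := by
      simp only [u, map_smul, norm_smul, norm_inv, norm_norm]
      ring
    rw [this, div_le_one (hv0 n)]
    exact (hv n).le
  have hTu : Tendsto (fun n ↦ T (u n)) atTop (𝓝 0) := by
    refine squeeze_zero_norm' ?_ tendsto_one_div_atTop_nhds_zero_nat
    filter_upwards [eventually_gt_atTop 0] with n hn
    rw [le_div_iff₀ (by exact_mod_cast hn), mul_comm]
    exact hTu_le n
  obtain ⟨z, -, φ, hφ, hz⟩ := (hK (Metric.closedBall 0 1) Metric.isBounded_closedBall).tendsto_subseq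
    (x := fun n ↦ K (u n))
    fun n ↦ subset_closure ⟨u n, by simp [hu n], rfl⟩
  have hTφ := hTu.comp hφ.tendsto_atTop
  have hcauchy : CauchySeq (u ∘ φ) := by
    have hgraph : AntilipschitzWith (2 * C₀).toNNReal (T.prod K) := by
      refine (T.prod K).antilipschitz_of_bound fun x ↦ ?_
      have h1 : ‖T x‖ ≤ ‖(T.prod K) x‖ := norm_fst_le ((T.prod K) x)
      have h2 : ‖K x‖ ≤ ‖(T.prod K) x‖ := norm_snd_le ((T.prod K) x)
      rcases le_or_gt 0 C₀ with hC | hC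
      · rw [Real.coe_toNNReal _ (by positivity)]
        nlinarith [hapr x, mul_le_mul_of_nonneg_left (add_le_add h1 h2) hC]
      · have : ‖x‖ ≤ 0 := (hapr x).trans
          (mul_nonpos_of_nonpos_of_nonneg hC.le (by positivity))
        exact this.trans (by positivity)
    refine (hgraph.isUniformInducing (T.prod K).uniformContinuous).cauchy_map_iff.mp ?_
    exact (hTφ.prodMk_nhds hz).cauchySeq
  obtain ⟨x, hx⟩ := cauchySeq_tendsto_of_complete hcauchy
  have hTx : T x = 0 := tendsto_nhds_unique ((T.continuous.tendsto x).comp hx) hTφ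
  have hx1 : ‖x‖ = 1 := tendsto_nhds_unique hx.norm (by simp [hu])
  rw [hT (hTx.trans (map_zero T).symm)] at hx1
  simp at hx1

/-- A continuous linear map satisfying an a priori estimate modulo a compact map restricts to a
closed embedding on every closed subspace meeting its kernel trivially. -/
theorem isClosedEmbedding_comp_subtypeL_of_apriori_estimate {E F Z : Type*}
    [NormedAddCommGroup E] [NormedSpace ℝ E] [CompleteSpace E]
    [NormedAddCommGroup F] [NormedSpace ℝ F]
    [NormedAddCommGroup Z] [NormedSpace ℝ Z]
    (T : E →L[ℝ] F) (K : E →L[ℝ] Z)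
    (hK : ∀ s : Set E, Bornology.IsBounded s → IsCompact (closure (K '' s)))
    (C₀ : ℝ) (hapr : ∀ u : E, ‖u‖ ≤ C₀ * (‖T u‖ + ‖K u‖))
    (V : Submodule ℝ E) (hV : IsClosed (V : Set E)) (hker : ∀ u ∈ V, T u = 0 → u = 0) :
    Topology.IsClosedEmbedding (T ∘L V.subtypeL) := by
  have : CompleteSpace V := hV.completeSpace_coe
  obtain ⟨C, hC⟩ := exists_antilipschitzWith_of_apriori_estimate (T ∘L V.subtypeL)
    (K ∘L V.subtypeL)
    (fun s hs ↦ by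
      have := hK (V.subtypeL '' s) (V.subtypeL.lipschitz.isBounded_image hs)
      rwa [← Set.image_comp] at this)
    C₀ (fun u ↦ hapr u)
    ((injective_iff_map_eq_zero _).mpr fun u hu ↦ Subtype.ext (hker u u.2 hu))
  exact hC.isClosedEmbedding (T ∘L V.subtypeL).uniformContinuous

theorem stmt_14 {H W Z : Type*}
    [NormedAddCommGroup H] [InnerProductSpace ℝ H] [CompleteSpace H]
    [NormedAddCommGroup W] [InnerProductSpace ℝ W] [CompleteSpace W]
    [NormedAddCommGroup Z] [NormedSpace ℝ Z] [CompleteSpace Z]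
    (ι : W →L[ℝ] H) (hinj : Function.Injective (⇑ι)) (hdense : DenseRange (⇑ι))
    (A : W →L[ℝ] H) (K : W →L[ℝ] Z)
    (hK : ∀ s : Set W, Bornology.IsBounded s → IsCompact (closure (K '' s)))
    (C₀ : ℝ) (hC₀ : 0 < C₀) (hapr : ∀ u : W, ‖u‖ ≤ C₀ * (‖A u‖ + ‖K u‖)) :
    IsClosed (Set.range (⇑A)) ∧
    ∀ (g : H) (useq : ℕ → W),
      (∀ k, ∀ v : W, A v = 0 → ⟪ι (useq k), ι v⟫ = 0) →
      Tendsto (fun k => A (useq k)) atTop (𝓝 g) →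
      ∃ ulim : W, Tendsto useq atTop (𝓝 ulim) ∧ A ulim = g := by
  constructor
  · let N : Submodule ℝ W := LinearMap.ker A.toLinearMap
    have : CompleteSpace N := A.isClosed_ker.completeSpace_coe
    have hemb := isClosedEmbedding_comp_subtypeL_of_apriori_estimate A K hK C₀ hapr Nᗮ
      N.isClosed_orthogonal fun u hu hAu ↦ inner_self_eq_zero (𝕜 := ℝ).mp (hu u hAu)
    convert hemb.isClosed_range using 1
    refine Set.Subset.antisymm ?_ (Set.range_comp_subset_range Nᗮ.subtypeL A)
    rintro _ ⟨w, rfl⟩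
    obtain ⟨y, hy, z, hz, rfl⟩ := N.exists_add_mem_mem_orthogonal w
    have hAy : A y = 0 := hy
    exact ⟨⟨z, hz⟩, by simp [hAy]⟩
  · intro g useq horth hlim
    let V : Submodule ℝ W :=
      ((LinearMap.ker A.toLinearMap).map ι.toLinearMap)ᗮ.comap ι.toLinearMap
    have hV : IsClosed (V : Set W) := (Submodule.isClosed_orthogonal _).preimage ι.continuous
    have hemb := isClosedEmbedding_comp_subtypeL_of_apriori_estimate A K hK C₀ hapr V hV
      fun u hu hAu ↦ hinj <| by
        rw [map_zero]
        exact inner_self_eq_zero (𝕜 := ℝ).mp (hu (ι u) ⟨u, hAu, rfl⟩)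
    have hmem : ∀ k, useq k ∈ V := by
      rintro k _ ⟨v, hv, rfl⟩
      rw [real_inner_comm]
      exact horth k v hv
    let useqV : ℕ → V := fun k ↦ ⟨useq k, hmem k⟩
    obtain ⟨x, rfl⟩ := hemb.isClosed_range.mem_of_tendsto hlim
      (.of_forall fun k ↦ ⟨useqV k, rfl⟩)
    have hx : Tendsto useqV atTop (𝓝 x) := hemb.tendsto_nhds_iff.mpr hlim
    exact ⟨x, (continuous_subtype_val.tendsto x).comp hx, rfl⟩
end
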